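/- arXiv:2005.12363 — 2 statements merged into one kernel-verified Lean document; each statement's English description precedes it below -/
import Mathlib

section
/- Let w be a complex number with Re(w) > −1 and let z be any complex number. Then Σ_{k=0}^{∞} binom(w, k) · binom(k, z) · binom(z, k) = binom(w, z). -/
/-- The generalized binomial coefficient `binom w z = Γ(w+1) / (Γ(z+1) Γ(w-z+1))`. -/
noncomputable def cbinom (w z : ℂ) : ℂ :=
  Complex.Gamma (w + 1) / (Complex.Gamma (z + 1) * Complex.Gamma (w - z + 1))

open Filter Asymptotics Topology MeasureTheory Complex

theorem cbinom_zero_right {w : ℂ} (hw : -1 < w.re) : cbinom w 0 = 1 := by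
  have h : Gamma (w + 1) ≠ 0 := Gamma_ne_zero_of_re_pos (by simp; linarith)
  simp [cbinom, h]

theorem add_one_mul_cbinom_add_one (w z : ℂ) :
    (z + 1) * cbinom w (z + 1) = (w - z) * cbinom w z := by
  have h1 := one_div_Gamma_eq_self_mul_one_div_Gamma_add_one (z + 1)
  have h2 := one_div_Gamma_eq_self_mul_one_div_Gamma_add_one (w - z)
  simp only [cbinom, div_eq_mul_inv, mul_inv]
  rw [show w - (z + 1) + 1 = w - z by ring, h1, h2]
  ring

theorem add_one_mul_choose_add_one (w : ℂ) (n : ℕ) :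
    ((n : ℂ) + 1) * Ring.choose w (n + 1) = (w - n) * Ring.choose w n := by
  have h := Ring.descPochhammer_eq_factorial_smul_choose w n
  have h' := Ring.descPochhammer_eq_factorial_smul_choose w (n + 1)
  rw [descPochhammer_succ_right, Polynomial.smeval_mul, h] at h'
  have hf : (n.factorial : ℂ) ≠ 0 := by exact_mod_cast n.factorial_ne_zero
  apply mul_left_cancel₀ hf
  simp [Polynomial.smeval_sub, Polynomial.smeval_natCast, Nat.factorial_succ] at h'
  linear_combination -h'

theorem cbinom_natCast_right {w : ℂ} (hw : -1 < w.re) (n : ℕ) :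
    cbinom w n = Ring.choose w n := by
  induction n with
  | zero => simpa using cbinom_zero_right hw
  | succ n ih =>
    have h := add_one_mul_cbinom_add_one w n
    rw [ih, ← add_one_mul_choose_add_one] at h
    simpa using mul_left_cancel₀ n.cast_add_one_ne_zero h

/-- The normalized cardinal sine `sin (π (z - n)) / (π (z - n))`, with value `1` at `z = n`,
written with reciprocal Gamma functions. -/
noncomputable def gammaSinc (z : ℂ) (n : ℕ) : ℂ :=
  (Gamma (z - n + 1))⁻¹ * (Gamma (n - z + 1))⁻¹

theorem cbinom_mul_cbinom_eq_gammaSinc (z : ℂ) (n : ℕ) :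
    cbinom n z * cbinom z n = gammaSinc z n := by
  have hn : Gamma (n + 1) ≠ 0 := Gamma_ne_zero_of_re_pos (by simp; positivity)
  by_cases hz : Gamma (z + 1) = 0
  · obtain ⟨m, hm⟩ := (Gamma_eq_zero_iff _).1 hz
    have : Gamma (z - n + 1) = 0 :=
      (Gamma_eq_zero_iff _).2 ⟨m + n, by push_cast; linear_combination hm⟩
    simp [cbinom, gammaSinc, hz, this]
  · simp only [cbinom, gammaSinc]
    field_simp

theorem gammaSinc_sub_one (z : ℂ) (n : ℕ) : gammaSinc (z - 1) n = gammaSinc z (n + 1) := by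
  simp only [gammaSinc]
  push_cast
  ring_nf

theorem sub_mul_gammaSinc (z : ℂ) (n : ℕ) :
    (z - n) * gammaSinc z n = (n + 1 - z) * gammaSinc z (n + 1) := by
  have h1 := one_div_Gamma_eq_self_mul_one_div_Gamma_add_one (z - n)
  have h2 := one_div_Gamma_eq_self_mul_one_div_Gamma_add_one (n + 1 - z)
  simp only [gammaSinc]
  push_cast
  rw [show z - (n + 1) + 1 = z - n by ring, h1, show (n : ℂ) - z + 1 = n + 1 - z by ring, h2]
  ring

theorem sub_mul_gammaSinc_eq (z : ℂ) (n : ℕ) :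
    (z - n) * gammaSinc z n = (-1) ^ n * ((Gamma z)⁻¹ * (Gamma (1 - z))⁻¹) := by
  induction n with
  | zero =>
    simp only [gammaSinc, one_div_Gamma_eq_self_mul_one_div_Gamma_add_one z]
    simp
    ring_nf
  | succ n ih =>
    rw [sub_mul_gammaSinc] at ih
    push_cast
    linear_combination -ih

theorem isBigO_inv_sub_natCast (z : ℂ) :
    (fun n : ℕ ↦ (z - n)⁻¹) =O[atTop] fun n : ℕ ↦ (n : ℝ) ^ (-1 : ℝ) := by
  refine IsBigO.of_bound 2 ?_
  filter_upwards [eventually_ge_atTop (⌈2 * ‖z‖⌉₊ + 1)] with n hn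
  have hn' : 2 * ‖z‖ + 1 ≤ n := (add_le_add_left (Nat.le_ceil _) 1).trans (by exact_mod_cast hn)
  have h : (n : ℝ) / 2 ≤ ‖z - n‖ := by
    have := norm_sub_norm_le (n : ℂ) z
    rw [norm_sub_rev, norm_natCast] at this
    linarith
  have hpos : (0 : ℝ) < n := by linarith [norm_nonneg z]
  rw [norm_inv, Real.rpow_neg_one, norm_inv, Real.norm_natCast]
  calc ‖z - n‖⁻¹ ≤ ((n : ℝ) / 2)⁻¹ := by gcongr
    _ = 2 * (n : ℝ)⁻¹ := by rw [inv_div]; ring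

theorem gammaSinc_isBigO (z : ℂ) :
    gammaSinc z =O[atTop] fun n : ℕ ↦ (n : ℝ) ^ (-1 : ℝ) := by
  have h : (fun n : ℕ ↦ (-1) ^ n * ((Gamma z)⁻¹ * (Gamma (1 - z))⁻¹)) =O[atTop]
      fun _ : ℕ ↦ (1 : ℝ) :=
    IsBigO.of_bound ‖(Gamma z)⁻¹ * (Gamma (1 - z))⁻¹‖ (by simp)
  refine ((isBigO_inv_sub_natCast z).mul h).congr' ?_ (by simp)
  filter_upwards [eventually_ge_atTop (⌈‖z‖⌉₊ + 1)] with n hn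
  have hz : z - n ≠ 0 := by
    rintro h0
    have : ‖z‖ = n := by rw [sub_eq_zero.1 h0, norm_natCast]
    rw [this, Nat.ceil_natCast] at hn
    omega
  rw [← sub_mul_gammaSinc_eq, inv_mul_cancel_left₀ hz]

theorem sub_mul_choose_mul_GammaSeq {w : ℂ} (hw : ∀ m : ℕ, w ≠ m) (n : ℕ) :
    (w - n) * Ring.choose w n * GammaSeq (-w) n = (-1) ^ (n + 1) * (n : ℂ) ^ (-w) := by
  have hprod : (w - n) * Ring.choose w n * n.factorial =
      (-1) ^ (n + 1) * ∏ j ∈ Finset.range (n + 1), (-w + j) := by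
    induction n with
    | zero => simp
    | succ n ih =>
      rw [Finset.prod_range_succ, pow_succ, Nat.factorial_succ]
      push_cast
      have := add_one_mul_choose_add_one w n
      linear_combination (w - (n + 1)) * ih + (w - (n + 1)) * n.factorial * this
  have hne : ∏ j ∈ Finset.range (n + 1), (-w + (j : ℂ)) ≠ 0 :=
    Finset.prod_ne_zero_iff.2 fun j _ h ↦ hw j (by linear_combination -h)
  rw [GammaSeq]
  field_simp
  linear_combination (n : ℂ) ^ (-w) * hprod

theorem choose_isBigO (w : ℂ) :
    (fun n ↦ Ring.choose w n) =O[atTop] fun n : ℕ ↦ (n : ℝ) ^ (-(w.re + 1)) := by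
  by_cases hw : ∀ m : ℕ, w ≠ m
  · have hΓ : Gamma (-w) ≠ 0 := Gamma_ne_zero fun m h ↦ hw m (neg_inj.1 h)
    have h1 : (fun n ↦ (GammaSeq (-w) n)⁻¹) =O[atTop] fun _ : ℕ ↦ (1 : ℝ) :=
      ((GammaSeq_tendsto_Gamma (-w)).inv₀ hΓ).isBigO_one ℝ
    have h2 : (fun n : ℕ ↦ (-1) ^ (n + 1) * (n : ℂ) ^ (-w)) =O[atTop]
        fun n : ℕ ↦ (n : ℝ) ^ (-w.re) := by
      refine IsBigO.of_bound 1 ?_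
      filter_upwards [eventually_gt_atTop 0] with n hn
      rw [norm_mul, norm_natCast_cpow_of_pos hn, Real.norm_of_nonneg (by positivity)]
      simp
    refine ((isBigO_inv_sub_natCast w).mul (h2.mul h1)).congr' ?_ ?_
    · filter_upwards [(GammaSeq_tendsto_Gamma (-w)).eventually_ne hΓ] with n hn
      have := sub_ne_zero.2 (hw n)
      rw [← sub_mul_choose_mul_GammaSeq hw]
      field_simp
    · filter_upwards [eventually_gt_atTop 0] with n hn
      rw [mul_one, ← Real.rpow_add (by exact_mod_cast hn)]
      ring_nf
  · push Not at hw
    obtain ⟨m, rfl⟩ := hw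
    refine IsBigO.of_bound 1 ?_
    filter_upwards [eventually_gt_atTop m] with n hn
    rw [Ring.choose_natCast, Nat.choose_eq_zero_of_lt hn]
    simp

theorem summable_choose_mul {w : ℂ} (hw : -1 < w.re) {f : ℕ → ℂ}
    (hf : f =O[atTop] fun n : ℕ ↦ (n : ℝ) ^ (-1 : ℝ)) :
    Summable fun n ↦ Ring.choose w n * f n := by
  refine summable_of_isBigO_nat (Real.summable_nat_rpow.2 (by linarith : -(w.re + 2) < -1))
    (((choose_isBigO w).mul hf).congr' .rfl ?_)
  filter_upwards [eventually_gt_atTop 0] with n hn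
  rw [← Real.rpow_add (by exact_mod_cast hn)]
  ring_nf

theorem tendsto_choose_zero {w : ℂ} (hw : -1 < w.re) :
    Tendsto (fun n ↦ Ring.choose w n) atTop (𝓝 0) :=
  (choose_isBigO w).trans_tendsto
    ((tendsto_rpow_neg_atTop (by linarith)).comp tendsto_natCast_atTop_atTop)

theorem mul_tsum_choose_mul_gammaSinc {w : ℂ} (hw : -1 < w.re) (z : ℂ) :
    z * ∑' n, Ring.choose w n * gammaSinc z n =
      (w + 1 - z) * ∑' n, Ring.choose w n * gammaSinc (z - 1) n := by
  have hs (z : ℂ) := summable_choose_mul hw (gammaSinc_isBigO z)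
  rw [← sub_eq_zero, ← tsum_mul_left, ← tsum_mul_left,
    ← ((hs z).mul_left z).tsum_sub ((hs (z - 1)).mul_left (w + 1 - z))]
  set u : ℕ → ℂ := fun n ↦ n * (Ring.choose w n * gammaSinc z n)
  have hu (n : ℕ) : z * (Ring.choose w n * gammaSinc z n) -
      (w + 1 - z) * (Ring.choose w n * gammaSinc (z - 1) n) = u n - u (n + 1) := by
    simp only [u, gammaSinc_sub_one]
    push_cast
    linear_combination Ring.choose w n * sub_mul_gammaSinc z n +
      gammaSinc z (n + 1) * add_one_mul_choose_add_one w n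
  have hu0 : Tendsto u atTop (𝓝 0) := by
    have hb : (fun n : ℕ ↦ n * gammaSinc z n) =O[atTop] fun _ ↦ (1 : ℝ) := by
      have hn : (fun n : ℕ ↦ (n : ℂ)) =O[atTop] fun n : ℕ ↦ (n : ℝ) :=
        IsBigO.of_bound 1 (by simp)
      refine (hn.mul (gammaSinc_isBigO z)).congr' .rfl ?_
      filter_upwards [eventually_gt_atTop 0] with n hn
      rw [Real.rpow_neg_one, mul_inv_cancel₀ (by positivity)]
    have := hb.mul_isLittleO ((isLittleO_one_iff ℝ).2 (tendsto_choose_zero hw))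
    simp only [mul_one, isLittleO_one_iff] at this
    exact this.congr fun n ↦ by simp only [u]; ring
  have hsum := (((hs z).mul_left z).sub ((hs (z - 1)).mul_left (w + 1 - z))).hasSum
  refine tendsto_nhds_unique hsum.tendsto_sum_nat ?_
  simp only [hu, Finset.sum_range_sub']
  simpa [u] using hu0.const_sub (u 0)

theorem hasSum_one_sub_cpow (w : ℂ) {x : ℂ} (hx : ‖x‖ < 1) :
    HasSum (fun n ↦ (-1) ^ n * Ring.choose w n * x ^ n) ((1 - x) ^ w) := by
  have h := (one_add_cpow_hasFPowerSeriesOnBall_zero (a := w)).hasSum (y := -x)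
    (by rw [← ENNReal.ofReal_one, Metric.eball_ofReal]; simpa using hx)
  rw [zero_add, ← sub_eq_add_neg] at h
  refine h.congr_fun fun n ↦ ?_
  rw [binomialSeries_apply, List.ofFn_const, List.prod_replicate, smul_eq_mul, neg_pow x]
  ring

theorem hasSum_betaIntegral {s w : ℂ} (hs : 0 < s.re) (hw : -1 < w.re) :
    HasSum (fun n : ℕ ↦ (-1) ^ n * Ring.choose w n * (s + n)⁻¹) (betaIntegral s (w + 1)) := by
  set F : ℕ → ℝ → ℂ := fun n x ↦ (-1) ^ n * Ring.choose w n * (x : ℂ) ^ (s + n - 1)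
  have hre (n : ℕ) : -1 < (s + n - 1).re := by
    simp only [sub_re, add_re, natCast_re, one_re]
    have : (0 : ℝ) ≤ n := n.cast_nonneg
    linarith
  have hint (n : ℕ) : IntegrableOn (F n) (Set.Ioo 0 1) :=
    ((intervalIntegral.integrableOn_Ioo_cpow_iff one_pos).2 (hre n)).const_mul _
  have hF (n : ℕ) : ∫ x in Set.Ioo (0 : ℝ) 1, F n x =
      (-1) ^ n * Ring.choose w n * (s + n)⁻¹ := by
    have hne : s + n ≠ 0 := fun h ↦ by have := hre n; simp [h] at this
    rw [integral_const_mul, ← integral_Ioc_eq_integral_Ioo,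
      ← intervalIntegral.integral_of_le zero_le_one, integral_cpow (.inl (hre n))]
    simp [hne]
  have hnorm (n : ℕ) : ∫ x in Set.Ioo (0 : ℝ) 1, ‖F n x‖ =
      ‖Ring.choose w n * (-s.re - n : ℂ)⁻¹‖ := by
    have hpos : 0 < s.re + n := by positivity
    have : Set.EqOn (fun x ↦ ‖F n x‖) (fun x ↦ ‖Ring.choose w n‖ * x ^ (s.re + n - 1))
        (Set.Ioo 0 1) := fun x hx ↦ by
      simp [F, norm_cpow_eq_rpow_re_of_pos hx.1]
    rw [setIntegral_congr_fun measurableSet_Ioo this, integral_const_mul,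
      ← integral_Ioc_eq_integral_Ioo, ← intervalIntegral.integral_of_le zero_le_one,
      integral_rpow (.inl (by linarith))]
    have h : (-s.re - n : ℂ) = ((-(s.re + n) : ℝ) : ℂ) := by push_cast; ring
    rw [h, norm_mul, norm_inv, norm_real, norm_neg, Real.norm_of_nonneg hpos.le]
    simp [hpos.ne']
  have hsum : Summable fun n ↦ ∫ x in Set.Ioo (0 : ℝ) 1, ‖F n x‖ := by
    simp only [hnorm]
    exact (summable_choose_mul hw (isBigO_inv_sub_natCast _)).norm
  have key := hasSum_integral_of_summable_integral_norm hint hsum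
  simp only [hF] at key
  suffices h : betaIntegral s (w + 1) = ∫ x in Set.Ioo (0 : ℝ) 1, ∑' n, F n x by rwa [h]
  rw [betaIntegral, intervalIntegral.integral_of_le zero_le_one, integral_Ioc_eq_integral_Ioo]
  refine setIntegral_congr_fun measurableSet_Ioo fun x hx ↦ ?_
  have hx0 : (x : ℂ) ≠ 0 := ofReal_ne_zero.2 hx.1.ne'
  have hb := hasSum_one_sub_cpow w (x := x)
    (by rw [norm_real, Real.norm_of_nonneg hx.1.le]; exact hx.2)
  simp only [add_sub_cancel_right]
  rw [← (hb.mul_left ((x : ℂ) ^ (s - 1))).tsum_eq]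
  congr with n
  simp only [F]
  rw [add_sub_right_comm, cpow_add _ _ hx0, cpow_natCast]
  ring

theorem tsum_choose_mul_gammaSinc_of_re_neg {w z : ℂ} (hw : -1 < w.re) (hz : z.re < 0) :
    ∑' n, Ring.choose w n * gammaSinc z n = cbinom w z := by
  have hb := hasSum_betaIntegral (s := -z) (by simpa using hz) hw
  have hterm (n : ℕ) : Ring.choose w n * gammaSinc z n =
      -((Gamma z)⁻¹ * (Gamma (1 - z))⁻¹) * ((-1) ^ n * Ring.choose w n * (-z + n)⁻¹) := by
    have hne : z - n ≠ 0 := fun h ↦ by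
      rw [sub_eq_zero.1 h, natCast_re] at hz
      exact absurd hz (not_lt.2 n.cast_nonneg)
    have h := sub_mul_gammaSinc_eq z n
    rw [show -z + (n : ℂ) = -(z - n) by ring, inv_neg, ← mul_right_inj' hne]
    field_simp
    linear_combination Ring.choose w n * h
  have hz0 : z ≠ 0 := by rintro rfl; simp at hz
  have hΓz : Gamma (-z) ≠ 0 := Gamma_ne_zero_of_re_pos (by simpa using hz)
  have hΓ : Gamma (w - z + 1) ≠ 0 := Gamma_ne_zero_of_re_pos (by simp; linarith)
  have hB := Gamma_mul_Gamma_eq_betaIntegral (s := -z) (t := w + 1) (by simpa using hz)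
    (by simp; linarith)
  rw [show -z + (w + 1) = w - z + 1 by ring] at hB
  have h1 : Gamma (1 - z) = -z * Gamma (-z) := by
    rw [← Gamma_add_one _ (neg_ne_zero.2 hz0)]; ring_nf
  simp only [hterm]
  rw [(hb.mul_left _).tsum_eq, cbinom, one_div_Gamma_eq_self_mul_one_div_Gamma_add_one z, h1,
    eq_div_of_mul_eq hΓ ((mul_comm _ _).trans hB.symm), div_eq_mul_inv, div_eq_mul_inv]
  rw [mul_inv, mul_inv, inv_neg]
  field_simp

theorem tsum_choose_mul_gammaSinc {w : ℂ} (hw : -1 < w.re) (z : ℂ) :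
    ∑' n, Ring.choose w n * gammaSinc z n = cbinom w z := by
  obtain ⟨m, hm⟩ := exists_nat_gt z.re
  induction m generalizing z with
  | zero => exact tsum_choose_mul_gammaSinc_of_re_neg hw (by simpa using hm)
  | succ m ih =>
    rcases eq_or_ne z 0 with rfl | hz
    · rw [cbinom_zero_right hw, tsum_eq_single 0]
      · simp [gammaSinc]
      · intro n hn
        have h : Gamma (-n + 1) = 0 := by
          obtain ⟨k, rfl⟩ := Nat.exists_eq_succ_of_ne_zero hn
          exact (Gamma_eq_zero_iff _).2 ⟨k, by push_cast; ring⟩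
        simp [gammaSinc, h]
    · have h := mul_tsum_choose_mul_gammaSinc hw z
      rw [ih (z - 1) (by push_cast at hm; simp; linarith)] at h
      have h' := add_one_mul_cbinom_add_one w (z - 1)
      rw [sub_add_cancel] at h'
      apply mul_left_cancel₀ hz
      rw [h, h']
      ring

theorem series_binom_binom_binom (w : ℂ) (hw : -1 < w.re) (z : ℂ) :
    HasSum (fun k : ℕ => cbinom w (k : ℂ) * cbinom (k : ℂ) z * cbinom z (k : ℂ))
      (cbinom w z) := by
  simp only [mul_assoc, cbinom_mul_cbinom_eq_gammaSinc, cbinom_natCast_right hw]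
  rw [← tsum_choose_mul_gammaSinc hw z]
  exact (summable_choose_mul hw (gammaSinc_isBigO z)).hasSum
end

section
/- Let w be a complex number with Re(w) > −1 and let α be a complex number with Im(α) > 0 or α a positive integer. Then ∫_{−∞}^{∞} binom(w, x) / (x + α) dx = Σ_{k=0}^{∞} binom(w, k) / (k + α) − e^{iπα} · B(w+1, α), where B is the beta function. -/
open scoped Real
open MeasureTheory

/-- The beta function `B(p,q) = Γ(p)Γ(q)/Γ(p+q)`. -/
noncomputable def cbeta (p q : ℂ) : ℂ :=
  Complex.Gamma p * Complex.Gamma q / Complex.Gamma (p + q)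

theorem cbinom_natCast_zero {w : ℂ} (hw : -1 < w.re) : cbinom w (0 : ℕ) = 1 := by
  have h : Complex.Gamma (w + 1) ≠ 0 :=
    Complex.Gamma_ne_zero_of_re_pos (by simp; linarith)
  simp [cbinom, h]

theorem cbinom_natCast_succ (w : ℂ) (k : ℕ) :
    ((k : ℂ) + 1) * cbinom w ((k + 1 : ℕ) : ℂ) = (w - k) * cbinom w k := by
  have hk : (k : ℂ) + 1 ≠ 0 := by exact_mod_cast Nat.succ_ne_zero k
  have h1 := Complex.Gamma_add_one ((k : ℂ) + 1) hk
  have h2 := Complex.one_div_Gamma_eq_self_mul_one_div_Gamma_add_one (w - k)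
  have h3 : w - ((k + 1 : ℕ) : ℂ) + 1 = w - k := by push_cast; ring
  unfold cbinom
  rw [h3]
  push_cast
  simp only [div_eq_mul_inv, mul_inv, h1, h2]
  field_simp

theorem cbinom_natCast_eq_choose {w : ℂ} (hw : -1 < w.re) (k : ℕ) :
    cbinom w k = Ring.choose w k := by
  induction k with
  | zero => simpa using cbinom_natCast_zero hw
  | succ k ih =>
    have hk : (k : ℂ) + 1 ≠ 0 := by exact_mod_cast Nat.succ_ne_zero k
    apply mul_left_cancel₀ hk
    rw [cbinom_natCast_succ, ih]
    have h1 := Ring.descPochhammer_eq_factorial_smul_choose w k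
    have h2 := Ring.descPochhammer_eq_factorial_smul_choose w (k + 1)
    rw [descPochhammer_succ_right, Polynomial.smeval_mul, h1] at h2
    simp only [Polynomial.smeval_sub, Polynomial.smeval_X, pow_one, Polynomial.smeval_natCast,
      pow_zero, nsmul_eq_mul, mul_one, Nat.factorial_succ, Nat.cast_mul, Nat.cast_add,
      Nat.cast_one] at h2
    have hf : (k.factorial : ℂ) ≠ 0 := by exact_mod_cast k.factorial_ne_zero
    apply mul_left_cancel₀ hf
    linear_combination h2

theorem cbinom_natCast_succ_mul_factorial {w : ℂ} (hw : -1 < w.re) (n : ℕ) :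
    cbinom w ((n + 1 : ℕ) : ℂ) * (n + 1).factorial = ∏ j ∈ Finset.range (n + 1), (w - j) := by
  induction n with
  | zero =>
    have h := cbinom_natCast_succ w 0
    rw [cbinom_natCast_zero hw] at h
    simpa using h
  | succ n ih =>
    rw [Finset.prod_range_succ, ← ih, Nat.factorial_succ (n + 1)]
    have h := cbinom_natCast_succ w (n + 1)
    push_cast at h ⊢
    linear_combination ((n + 1).factorial : ℂ) * h

theorem exists_norm_cbinom_natCast_succ_le {w : ℂ} (hw : -1 < w.re) :
    ∃ C : ℝ, ∀ n : ℕ, 1 ≤ n → ‖cbinom w ((n + 1 : ℕ) : ℂ)‖ ≤ C * (n : ℝ) ^ (-w.re - 1) := by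
  suffices H : ∃ C : ℝ, ∀ n : ℕ, 1 ≤ n →
      ‖cbinom w ((n + 1 : ℕ) : ℂ)‖ * (n : ℝ) ^ (w.re + 1) ≤ C by
    obtain ⟨C, hC⟩ := H
    refine ⟨C, fun n hn ↦ ?_⟩
    have hn' : (0 : ℝ) < n := by exact_mod_cast hn
    rw [show -w.re - 1 = -(w.re + 1) by ring, Real.rpow_neg hn'.le, ← div_eq_mul_inv,
      le_div_iff₀ (by positivity)]
    exact hC n hn
  by_cases hm : ∃ m : ℕ, w = m
  · obtain ⟨m, rfl⟩ := hm
    let f : ℕ → ℝ := fun n ↦ ‖cbinom m ((n + 1 : ℕ) : ℂ)‖ * (n : ℝ) ^ ((m : ℂ).re + 1)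
    have hf : Filter.Tendsto f Filter.atTop (nhds 0) := by
      refine tendsto_const_nhds.congr' ?_
      filter_upwards [Filter.eventually_ge_atTop m] with n hn
      simp only [f]
      rw [cbinom_natCast_eq_choose hw, Ring.choose_natCast,
        Nat.choose_eq_zero_of_lt (by omega)]
      simp
    obtain ⟨C, hC⟩ := hf.bddAbove_range
    exact ⟨C, fun n _ ↦ hC ⟨n, rfl⟩⟩
  · have hG : Complex.Gamma (-w) ≠ 0 :=
      Complex.Gamma_ne_zero fun m h ↦ hm ⟨m, by simpa using h⟩
    have ht := ((Complex.GammaSeq_tendsto_Gamma (-w)).norm.inv₀ (by simpa using hG))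
    obtain ⟨C, hC⟩ := ht.bddAbove_range
    refine ⟨C, fun n hn ↦ le_trans ?_ (hC ⟨n, rfl⟩)⟩
    have hn' : (0 : ℝ) < n := by exact_mod_cast hn
    have h1 : ‖∏ j ∈ Finset.range (n + 1), (-w + (j : ℂ))‖ =
        ‖∏ j ∈ Finset.range (n + 1), (w - (j : ℂ))‖ := by
      rw [norm_prod, norm_prod]
      refine Finset.prod_congr rfl fun j _ ↦ ?_
      rw [← norm_neg]; ring_nf
    have h2 : ‖(n : ℂ) ^ (-w)‖ = (n : ℝ) ^ (-w.re) := by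
      have := Complex.norm_cpow_eq_rpow_re_of_pos hn' (-w)
      simpa using this
    simp only [Complex.GammaSeq]
    rw [norm_div, norm_mul, h1, h2, ← cbinom_natCast_succ_mul_factorial hw, norm_mul,
      Complex.norm_natCast, Complex.norm_natCast, Nat.factorial_succ, Real.rpow_neg hn'.le,
      Real.rpow_add hn', Real.rpow_one, inv_div]
    have hf : (0 : ℝ) < n.factorial := by exact_mod_cast n.factorial_pos
    have hp : (0 : ℝ) < (n : ℝ) ^ w.re := by positivity
    rw [le_div_iff₀ (by positivity)]
    push_cast
    field_simp
    gcongr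
    linarith

theorem tendsto_cbinom_natCast {w : ℂ} (hw : -1 < w.re) :
    Filter.Tendsto (fun k : ℕ ↦ cbinom w k) Filter.atTop (nhds 0) := by
  obtain ⟨C, hC⟩ := exists_norm_cbinom_natCast_succ_le hw
  rw [← Filter.tendsto_add_atTop_iff_nat 1]
  refine squeeze_zero_norm' (a := fun n : ℕ ↦ C * (n : ℝ) ^ (-w.re - 1)) ?_ ?_
  · filter_upwards [Filter.eventually_ge_atTop 1] with n hn using hC n hn
  · have := ((tendsto_rpow_neg_atTop (show 0 < w.re + 1 by linarith)).comp
      tendsto_natCast_atTop_atTop).const_mul C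
    simpa [Function.comp_def, neg_add, sub_eq_add_neg, add_comm] using this

theorem summable_norm_cbinom_mul_rpow {w : ℂ} {δ : ℝ} (hδ : δ ≤ 1) (hδw : δ < w.re + 1)
    (hw : -1 < w.re) :
    Summable fun k : ℕ ↦ ‖cbinom w k‖ * ((k : ℝ) + 1) ^ (-(1 - δ)) := by
  obtain ⟨C, hC⟩ := exists_norm_cbinom_natCast_succ_le hw
  rw [← summable_nat_add_iff 1]
  refine Summable.of_norm_bounded_eventually_nat
    (g := fun n : ℕ ↦ C * (n : ℝ) ^ (-w.re - 1 - (1 - δ)))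
    ((Real.summable_nat_rpow.2 (by linarith)).mul_left C) ?_
  filter_upwards [Filter.eventually_ge_atTop 1] with n hn
  have hn' : (0 : ℝ) < n := by exact_mod_cast hn
  rw [norm_mul, norm_norm, Real.norm_of_nonneg (by positivity),
    sub_eq_add_neg (-w.re - 1), Real.rpow_add hn', ← mul_assoc]
  refine mul_le_mul (hC n hn) ?_ (by positivity) ((norm_nonneg _).trans (hC n hn))
  exact Real.rpow_le_rpow_of_nonpos hn' (by push_cast; linarith) (by linarith)

theorem summable_norm_cbinom_div {w : ℂ} (hw : -1 < w.re) :
    Summable fun k : ℕ ↦ ‖cbinom w k‖ / ((k : ℝ) + 1) := by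
  have := summable_norm_cbinom_mul_rpow (w := w) (δ := 0) (by norm_num) (by linarith) hw
  simpa [Real.rpow_neg_one, div_eq_mul_inv] using this

theorem summable_cbinom_div_add {w : ℂ} (hw : -1 < w.re) (s : ℂ) :
    Summable fun k : ℕ ↦ ‖cbinom w k / ((k : ℂ) + s)‖ := by
  refine Summable.of_norm_bounded_eventually_nat ((summable_norm_cbinom_div hw).mul_left 4) ?_
  obtain ⟨N, hN⟩ := exists_nat_ge (2 * ‖s‖ + 1)
  filter_upwards [Filter.eventually_ge_atTop N] with k hk
  have hk' : 2 * ‖s‖ + 1 ≤ k := hN.trans (by exact_mod_cast hk)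
  have h1 : (k : ℝ) - ‖s‖ ≤ ‖(k : ℂ) + s‖ := by
    have := norm_sub_le ((k : ℂ) + s) s
    simp only [add_sub_cancel_right, Complex.norm_natCast] at this
    linarith
  have hs := norm_nonneg s
  rw [norm_norm, norm_div, ← mul_div_assoc, div_le_div_iff₀ (by linarith) (by linarith)]
  nlinarith [norm_nonneg (cbinom w k)]

theorem hasSum_neg_one_pow_mul_cbinom_mul_pow {w : ℂ} (hw : -1 < w.re) {x : ℝ}
    (hx : x ∈ Set.Ioo (0 : ℝ) 1) :
    HasSum (fun k : ℕ ↦ (-1 : ℂ) ^ k * cbinom w k * (x : ℂ) ^ k) ((1 - (x : ℂ)) ^ w) := by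
  have hmem : (-(x : ℂ)) ∈ Metric.eball (0 : ℂ) 1 := by
    rw [← ENNReal.ofReal_one, Metric.eball_ofReal]
    simpa [abs_of_pos hx.1] using hx.2
  have h := (Complex.one_add_cpow_hasFPowerSeriesOnBall_zero (a := w)).hasSum hmem
  rw [zero_add, ← sub_eq_add_neg] at h
  convert! h using 2 with k
  simp only [binomialSeries_apply, List.ofFn_const, List.prod_replicate, smul_eq_mul]
  rw [cbinom_natCast_eq_choose hw, neg_pow]
  ring

theorem hasSum_neg_one_pow_mul_cbinom_div_of_re_pos {w s : ℂ} (hw : -1 < w.re) (hs : 0 < s.re) :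
    HasSum (fun k : ℕ ↦ (-1 : ℂ) ^ k * cbinom w k / ((k : ℂ) + s)) (cbeta (w + 1) s) := by
  have hre : ∀ k : ℕ, -1 < ((k : ℂ) + s - 1).re := fun k ↦ by
    have : (0 : ℝ) ≤ k := k.cast_nonneg
    simp; linarith
  let F : ℕ → ℝ → ℂ := fun k x ↦ (-1 : ℂ) ^ k * cbinom w k * (x : ℂ) ^ ((k : ℂ) + s - 1)
  have hFint : ∀ k, IntegrableOn (F k) (Set.Ioc 0 1) := fun k ↦
    ((intervalIntegrable_iff_integrableOn_Ioc_of_le zero_le_one).1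
      (intervalIntegral.intervalIntegrable_cpow' (hre k))).const_mul _
  have hnorm : ∀ k, ∫ x in Set.Ioc (0 : ℝ) 1, ‖F k x‖ = ‖cbinom w k‖ / (k + s.re) := fun k ↦ by
    have h1 : ∀ x ∈ Set.Ioc (0 : ℝ) 1, ‖F k x‖ = ‖cbinom w k‖ * x ^ ((k : ℝ) + s.re - 1) := by
      intro x hx
      simp only [F, norm_mul, norm_pow, norm_neg, norm_one, one_pow, one_mul]
      rw [Complex.norm_cpow_eq_rpow_re_of_pos hx.1]
      simp
    have hr : -1 < (k : ℝ) + s.re - 1 := by simpa using hre k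
    rw [setIntegral_congr_fun measurableSet_Ioc h1, integral_const_mul,
      ← intervalIntegral.integral_of_le zero_le_one, integral_rpow (Or.inl hr)]
    have h2 : (k : ℝ) + s.re ≠ 0 := by linarith
    simp [Real.zero_rpow h2, div_eq_mul_inv]
  have hval : ∀ k, ∫ x in Set.Ioc (0 : ℝ) 1, F k x = (-1 : ℂ) ^ k * cbinom w k / ((k : ℂ) + s) :=
      fun k ↦ by
    have h2 : (k : ℂ) + s ≠ 0 := fun h ↦ by
      have := hre k
      rw [h] at this
      simp at this
    rw [integral_const_mul, ← intervalIntegral.integral_of_le zero_le_one,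
      integral_cpow (Or.inl (hre k))]
    simp [h2, div_eq_mul_inv]
  have hsum : Summable fun k ↦ ∫ x in Set.Ioc (0 : ℝ) 1, ‖F k x‖ := by
    refine (summable_cbinom_div_add hw s.re).congr fun k ↦ ?_
    have h2 : 0 < (k : ℝ) + s.re := by positivity
    rw [hnorm, norm_div, ← Complex.ofReal_natCast, ← Complex.ofReal_add, Complex.norm_real,
      Real.norm_of_nonneg h2.le]
  have h := hasSum_integral_of_summable_integral_norm (μ := volume.restrict (Set.Ioc (0 : ℝ) 1))
    hFint hsum
  simp only [hval] at h
  suffices hB : cbeta (w + 1) s = ∫ x in Set.Ioc (0 : ℝ) 1, ∑' k, F k x by rwa [hB]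
  rw [cbeta, mul_comm, add_comm (w + 1),
    ← Complex.betaIntegral_eq_Gamma_mul_div s (w + 1) hs (by simp; linarith),
    Complex.betaIntegral, intervalIntegral.integral_of_le zero_le_one,
    integral_Ioc_eq_integral_Ioo, integral_Ioc_eq_integral_Ioo]
  refine setIntegral_congr_fun measurableSet_Ioo fun x hx ↦ ?_
  have hx0 : (x : ℂ) ≠ 0 := by exact_mod_cast hx.1.ne'
  refine (HasSum.tsum_eq ?_).symm
  simp only [add_sub_cancel_right]
  convert! (hasSum_neg_one_pow_mul_cbinom_mul_pow hw hx).mul_left ((x : ℂ) ^ (s - 1)) using 2 with k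
  simp only [F]
  rw [add_sub_assoc, Complex.cpow_add _ _ hx0, Complex.cpow_natCast]
  ring

theorem cbeta_eq_add_one {p s : ℂ} (hs : s ≠ 0) :
    cbeta p s = (p + s) / s * cbeta p (s + 1) := by
  have h1 := Complex.Gamma_add_one s hs
  have h2 := Complex.one_div_Gamma_eq_self_mul_one_div_Gamma_add_one (p + s)
  simp only [cbeta, h1, div_eq_mul_inv, h2, add_assoc]
  field_simp

theorem hasSum_neg_one_pow_mul_cbinom_div_of_add_one {w s S : ℂ} (hw : -1 < w.re)
    (hs : ∀ k : ℕ, (k : ℂ) + s ≠ 0)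
    (h : HasSum (fun k : ℕ ↦ (-1 : ℂ) ^ k * cbinom w k / ((k : ℂ) + (s + 1))) S) :
    HasSum (fun k : ℕ ↦ (-1 : ℂ) ^ k * cbinom w k / ((k : ℂ) + s)) ((w + 1 + s) / s * S) := by
  have hs0 : s ≠ 0 := by simpa using hs 0
  have hsm : Summable fun k : ℕ ↦ (-1 : ℂ) ^ k * cbinom w k / ((k : ℂ) + s) :=
    Summable.of_norm ((summable_cbinom_div_add hw s).congr fun k ↦ by simp)
  let T : ℕ → ℂ := fun k ↦ k * ((-1 : ℂ) ^ k * cbinom w k) / ((k : ℂ) + s)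
  have hT0 : Filter.Tendsto T Filter.atTop (nhds 0) := by
    have h1 := (tendsto_zero_iff_norm_tendsto_zero.1 (tendsto_cbinom_natCast hw)).add
      ((hsm.tendsto_atTop_zero.norm).const_mul ‖s‖)
    simp only [norm_zero, mul_zero, add_zero] at h1
    refine squeeze_zero_norm (fun k ↦ ?_) h1
    have : T k = (-1 : ℂ) ^ k * cbinom w k - s * ((-1 : ℂ) ^ k * cbinom w k / ((k : ℂ) + s)) := by
      simp only [T]
      have := hs k
      field_simp
      ring
    rw [this]
    refine (norm_sub_le _ _).trans ?_
    simp
  have hrec : ∀ k : ℕ, s * ((-1 : ℂ) ^ k * cbinom w k / ((k : ℂ) + s)) =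
      (w + 1 + s) * ((-1 : ℂ) ^ k * cbinom w k / ((k : ℂ) + (s + 1))) + (T (k + 1) - T k) := by
    intro k
    have h1 := hs k
    have h2 := hs (k + 1)
    have h3 := cbinom_natCast_succ w k
    simp only [T]
    push_cast at h2 h3 ⊢
    have h4 : (k : ℂ) + (s + 1) ≠ 0 := by convert h2 using 1; ring
    have h5 : ((k : ℂ) + 1) * ((-1) ^ (k + 1) * cbinom w (k + 1)) =
      -(-1) ^ k * ((w - k) * cbinom w k) := by rw [← h3]; ring
    rw [h5, show (k : ℂ) + 1 + s = k + (s + 1) by ring]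
    field_simp
    ring
  have hsum : ∀ n : ℕ, ∑ k ∈ Finset.range n, s * ((-1 : ℂ) ^ k * cbinom w k / ((k : ℂ) + s)) =
      (w + 1 + s) * ∑ k ∈ Finset.range n, ((-1 : ℂ) ^ k * cbinom w k / ((k : ℂ) + (s + 1))) +
        T n := by
    intro n
    simp_rw [hrec, Finset.sum_add_distrib, Finset.sum_range_sub, Finset.mul_sum]
    simp [T]
  have hlim := (h.tendsto_sum_nat.const_mul (w + 1 + s)).add hT0
  simp only [← hsum, add_zero] at hlim
  have := tendsto_nhds_unique (hsm.mul_left s).hasSum.tendsto_sum_nat hlim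
  rw [tsum_mul_left] at this
  convert! hsm.hasSum using 1
  field_simp
  rw [← this]

theorem hasSum_neg_one_pow_mul_cbinom_div {w s : ℂ} (hw : -1 < w.re)
    (hs : ∀ k : ℕ, (k : ℂ) + s ≠ 0) :
    HasSum (fun k : ℕ ↦ (-1 : ℂ) ^ k * cbinom w k / ((k : ℂ) + s)) (cbeta (w + 1) s) := by
  obtain ⟨n, hn⟩ := exists_nat_gt (-s.re)
  induction n generalizing s with
  | zero => exact hasSum_neg_one_pow_mul_cbinom_div_of_re_pos hw (by simpa using hn)
  | succ n ih =>
    rw [cbeta_eq_add_one (by simpa using hs 0)]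
    refine hasSum_neg_one_pow_mul_cbinom_div_of_add_one hw hs (ih (fun k ↦ ?_) ?_)
    · have := hs (k + 1)
      push_cast at this
      convert this using 1
      ring
    · push_cast at hn
      simp
      linarith

open FourierTransform in
theorem fourier_indicator_Ioc_exp (k : ℕ) (x : ℝ) :
    𝓕 (Set.indicator (Set.Ioc (-(1 / 2) : ℝ) (1 / 2))
      fun t : ℝ ↦ Complex.exp (2 * π * Complex.I * k * t)) x = (Real.sinc (π * (x - k)) : ℂ) := by
  rw [Real.fourier_real_eq_integral_exp_smul]
  have h1 : ∀ t : ℝ, Complex.exp (↑(-2 * π * t * x) * Complex.I) •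
      Set.indicator (Set.Ioc (-(1 / 2) : ℝ) (1 / 2))
        (fun t : ℝ ↦ Complex.exp (2 * π * Complex.I * k * t)) t =
      Set.indicator (Set.Ioc (-(1 / 2) : ℝ) (1 / 2))
        (fun t : ℝ ↦ Complex.exp (2 * π * Complex.I * (k - x) * t)) t := by
    intro t
    rw [← Set.indicator_const_smul_apply, Set.indicator_apply, Set.indicator_apply]
    split_ifs
    · rw [smul_eq_mul, ← Complex.exp_add]
      congr 1
      push_cast
      ring
    · rfl
  simp_rw [h1]
  rw [integral_indicator measurableSet_Ioc, ← intervalIntegral.integral_of_le (by norm_num)]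
  by_cases hx : x = k
  · simp only [hx, Complex.ofReal_natCast, sub_self, mul_zero, zero_mul, Complex.exp_zero,
      Real.sinc_zero, intervalIntegral.integral_const]
    norm_num
  have hx' : (k : ℂ) - x ≠ 0 := fun h ↦ hx (by exact_mod_cast (sub_eq_zero.1 h).symm)
  have hx2 : (x : ℂ) - k ≠ 0 := fun h ↦ hx' (by linear_combination -h)
  have hπ : (π : ℂ) ≠ 0 := by exact_mod_cast Real.pi_ne_zero
  rw [integral_exp_mul_complex (by simp [hx', Real.pi_ne_zero]),
    Real.sinc_of_ne_zero (mul_ne_zero Real.pi_ne_zero (sub_ne_zero.2 hx))]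
  push_cast
  rw [Complex.sin, show 2 * (π : ℂ) * Complex.I * (k - x) * (1 / 2) = -(π * (x - k)) * Complex.I by
    ring, show 2 * (π : ℂ) * Complex.I * (k - x) * -(1 / 2) = (π * (x - k)) * Complex.I by ring,
    div_eq_div_iff (by simp [hx', Real.pi_ne_zero]) (by simp [hx2, Real.pi_ne_zero])]
  linear_combination (Complex.exp (-(π * (x - k)) * Complex.I) -
    Complex.exp ((π * (x - k)) * Complex.I)) * π * (x - k) * Complex.I_sq

open FourierTransform in
theorem fourier_indicator_Iic_exp {α : ℂ} (hα : 0 < α.im) (x : ℝ) :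
    𝓕 (Set.indicator (Set.Iic (0 : ℝ)) fun t : ℝ ↦ Complex.exp (-2 * π * Complex.I * α * t)) x =
      -(2 * π * Complex.I * (x + α))⁻¹ := by
  rw [Real.fourier_real_eq_integral_exp_smul]
  have h1 : ∀ t : ℝ, Complex.exp (↑(-2 * π * t * x) * Complex.I) •
      Set.indicator (Set.Iic (0 : ℝ))
        (fun t : ℝ ↦ Complex.exp (-2 * π * Complex.I * α * t)) t =
      Set.indicator (Set.Iic (0 : ℝ))
        (fun t : ℝ ↦ Complex.exp (-(2 * π * Complex.I * (x + α)) * t)) t := by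
    intro t
    rw [← Set.indicator_const_smul_apply, Set.indicator_apply, Set.indicator_apply]
    split_ifs
    · rw [smul_eq_mul, ← Complex.exp_add]
      congr 1
      push_cast
      ring
    · rfl
  simp_rw [h1]
  rw [integral_indicator measurableSet_Iic, integral_exp_mul_complex_Iic]
  · simp
  · simp
    positivity

theorem integrable_indicator_Ioc_exp (k : ℕ) :
    Integrable (Set.indicator (Set.Ioc (-(1 / 2) : ℝ) (1 / 2))
      fun t : ℝ ↦ Complex.exp (2 * π * Complex.I * k * t)) := by
  refine (integrable_indicator_iff measurableSet_Ioc).2 ?_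
  exact (Continuous.integrableOn_Icc (by fun_prop)).mono_set Set.Ioc_subset_Icc_self

theorem integrable_indicator_Iic_exp {α : ℂ} (hα : 0 < α.im) :
    Integrable (Set.indicator (Set.Iic (0 : ℝ))
      fun t : ℝ ↦ Complex.exp (-2 * π * Complex.I * α * t)) := by
  refine (integrable_indicator_iff measurableSet_Iic).2 (integrableOn_exp_mul_complex_Iic ?_ 0)
  simp
  positivity

open Convolution in
theorem convolution_indicator_exp (k : ℕ) {α : ℂ} (hα : 0 < α.im) {t : ℝ}
    (ht : t ∈ Set.Ioo (-(1 / 2) : ℝ) (1 / 2)) :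
    ((Set.indicator (Set.Ioc (-(1 / 2) : ℝ) (1 / 2))
      fun t : ℝ ↦ Complex.exp (2 * π * Complex.I * k * t)) ⋆[ContinuousLinearMap.mul ℂ ℂ]
      (Set.indicator (Set.Iic (0 : ℝ))
        fun t : ℝ ↦ Complex.exp (-2 * π * Complex.I * α * t))) t =
    Complex.exp (-2 * π * Complex.I * α * t) *
      ((Complex.exp (π * Complex.I * (k + α)) - Complex.exp (2 * π * Complex.I * (k + α) * t)) /
        (2 * π * Complex.I * (k + α))) := by
  have hkα : (k : ℂ) + α ≠ 0 := fun h ↦ by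
    have := congrArg Complex.im h
    simp at this
    exact hα.ne' this
  rw [convolution_def]
  have h1 : ∀ s : ℝ, s ≠ t → ContinuousLinearMap.mul ℂ ℂ
      (Set.indicator (Set.Ioc (-(1 / 2) : ℝ) (1 / 2))
        (fun t : ℝ ↦ Complex.exp (2 * π * Complex.I * k * t)) s)
      (Set.indicator (Set.Iic (0 : ℝ))
        (fun t : ℝ ↦ Complex.exp (-2 * π * Complex.I * α * t)) (t - s)) =
      Set.indicator (Set.Ioc t (1 / 2)) (fun s : ℝ ↦ Complex.exp (-2 * π * Complex.I * α * t) *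
        Complex.exp (2 * π * Complex.I * (k + α) * s)) s := by
    intro s hs
    simp only [ContinuousLinearMap.mul_apply', Set.indicator_apply, Set.mem_Ioc, Set.mem_Iic]
    by_cases h : t < s ∧ s ≤ 1 / 2
    · rw [if_pos ⟨ht.1.trans h.1, h.2⟩, if_pos (by linarith [h.1]), if_pos h, ← Complex.exp_add,
        ← Complex.exp_add]
      congr 1
      push_cast
      ring
    · rw [if_neg h]
      by_cases h2 : s ≤ 1 / 2
      · have h3 : s < t := lt_of_le_of_ne (not_lt.1 fun h' ↦ h ⟨h', h2⟩) hs
        rw [if_neg (show ¬ (t - s ≤ 0) by linarith), mul_zero]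
      · rw [if_neg (fun h' ↦ h2 h'.2), zero_mul]
  have h2 : ∀ᵐ s : ℝ, s ≠ t := by
    simpa using (Set.countable_singleton t).ae_notMem volume
  rw [integral_congr_ae (h2.mono h1), integral_indicator measurableSet_Ioc,
    ← intervalIntegral.integral_of_le ht.2.le, intervalIntegral.integral_const_mul,
    integral_exp_mul_complex (by simp [hkα, Real.pi_ne_zero])]
  congr 4
  push_cast
  ring

/-- The integrand obtained by replacing the binomial coefficient with a shifted `sinc`. -/
noncomputable def sincDiv (k : ℕ) (α : ℂ) (x : ℝ) : ℂ :=
  (Real.sinc (π * (x - k)) : ℂ) / ((x : ℂ) + α)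

open FourierTransform Convolution in
theorem integral_sincDiv_of_integrable (k : ℕ) {α : ℂ} (hα : 0 < α.im)
    (hInt : Integrable (sincDiv k α)) :
    ∫ x, sincDiv k α x = (1 - (-1) ^ k * Complex.exp (Complex.I * π * α)) / (k + α) := by
  have hkα : (k : ℂ) + α ≠ 0 := fun h ↦ by
    have := congrArg Complex.im h
    simp at this
    exact hα.ne' this
  have hπ : (π : ℂ) ≠ 0 := by exact_mod_cast Real.pi_ne_zero
  set u := (Set.indicator (Set.Ioc (-(1 / 2) : ℝ) (1 / 2))
      fun t : ℝ ↦ Complex.exp (2 * π * Complex.I * k * t)) ⋆[ContinuousLinearMap.mul ℂ ℂ]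
      (Set.indicator (Set.Iic (0 : ℝ))
        fun t : ℝ ↦ Complex.exp (-2 * π * Complex.I * α * t)) with hu
  have hF : 𝓕 u = fun x ↦ -(2 * π * Complex.I)⁻¹ * sincDiv k α x := by
    ext x
    rw [hu, Real.fourier_mul_convolution_eq (integrable_indicator_Ioc_exp k)
      (integrable_indicator_Iic_exp hα), fourier_indicator_Ioc_exp, fourier_indicator_Iic_exp hα,
      sincDiv, mul_inv]
    ring
  have hcont : ContinuousAt u 0 := by
    refine ContinuousAt.congr (f := fun t : ℝ ↦ Complex.exp (-2 * π * Complex.I * α * t) *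
      ((Complex.exp (π * Complex.I * (k + α)) - Complex.exp (2 * π * Complex.I * (k + α) * t)) /
        (2 * π * Complex.I * (k + α)))) (by fun_prop) ?_
    filter_upwards [Ioo_mem_nhds (show (-(1 / 2) : ℝ) < 0 by norm_num)
      (show (0 : ℝ) < 1 / 2 by norm_num)] with t ht
    exact (convolution_indicator_exp k hα ht).symm
  have hinv := MeasureTheory.Integrable.fourierInv_fourier_eq
    ((integrable_indicator_Ioc_exp k).integrable_convolution (ContinuousLinearMap.mul ℂ ℂ)
      (integrable_indicator_Iic_exp hα)) (by rw [← hu, hF]; exact hInt.const_mul _) hcont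
  rw [← hu, hF, Real.fourierInv_eq', hu, convolution_indicator_exp k hα (by norm_num)] at hinv
  simp only [inner_zero_right, mul_zero, Complex.ofReal_zero, zero_mul, Complex.exp_zero,
    one_smul, one_mul] at hinv
  rw [integral_const_mul] at hinv
  have hexp : Complex.exp (π * Complex.I * (k + α)) =
      (-1) ^ k * Complex.exp (Complex.I * π * α) := by
    rw [mul_add, Complex.exp_add, mul_comm _ (k : ℂ), Complex.exp_nat_mul, Complex.exp_pi_mul_I,
      mul_comm (π : ℂ)]
  rw [hexp] at hinv
  have hI := Complex.I_ne_zero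
  field_simp at hinv ⊢
  linear_combination -hinv

theorem abs_sinc_pi_mul_le (u : ℝ) : |Real.sinc (π * u)| ≤ 2 / (1 + |u|) := by
  have hu := abs_nonneg u
  rcases le_total |u| 1 with h | h
  · refine (Real.abs_sinc_le_one _).trans ?_
    rw [le_div_iff₀ (by positivity)]
    linarith
  · have hu0 : u ≠ 0 := by
      rintro rfl
      norm_num at h
    rw [Real.sinc_of_ne_zero (mul_ne_zero Real.pi_ne_zero hu0), abs_div, abs_mul,
      abs_of_pos Real.pi_pos, div_le_div_iff₀ (by positivity) (by positivity)]
    have h1 := Real.abs_sin_le_one (π * u)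
    have h2 := Real.pi_gt_three
    calc |Real.sin (π * u)| * (1 + |u|) ≤ 1 * (1 + |u|) := by gcongr
      _ ≤ 2 * (3 * |u|) := by linarith
      _ ≤ 2 * (π * |u|) := by gcongr

theorem measurable_sincDiv (k : ℕ) (α : ℂ) : Measurable (sincDiv k α) := by
  have h : Measurable fun x : ℝ ↦ Real.sinc (π * (x - k)) :=
    (Real.continuous_sinc.comp (by fun_prop)).measurable
  exact (Complex.measurable_ofReal.comp h).div (by fun_prop)

theorem exists_norm_sincDiv_le_of_im_pos {α : ℂ} (hα : 0 < α.im) :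
    ∃ C : ℝ, ∀ (k : ℕ) (x : ℝ), ‖sincDiv k α x‖ ≤ C * ((1 + |x - k|) * (1 + |x|))⁻¹ := by
  refine ⟨2 * (1 + (1 + ‖α‖) / α.im), fun k x ↦ ?_⟩
  have h1 : α.im ≤ ‖(x : ℂ) + α‖ := by
    simpa using (le_abs_self _).trans (Complex.abs_im_le_norm ((x : ℂ) + α))
  have h2 : |x| ≤ ‖(x : ℂ) + α‖ + ‖α‖ := by
    simpa using norm_sub_le ((x : ℂ) + α) α
  have h3 : 1 + ‖α‖ ≤ (1 + ‖α‖) / α.im * ‖(x : ℂ) + α‖ := by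
    rw [div_mul_eq_mul_div, le_div_iff₀ hα]
    gcongr
  have h4 : 0 < ‖(x : ℂ) + α‖ := hα.trans_le h1
  have h5 : (‖(x : ℂ) + α‖)⁻¹ ≤ (1 + (1 + ‖α‖) / α.im) * (1 + |x|)⁻¹ := by
    rw [← div_eq_mul_inv, inv_eq_one_div, div_le_div_iff₀ h4 (by positivity)]
    linarith
  rw [sincDiv, norm_div, Complex.norm_real, Real.norm_eq_abs, div_eq_mul_inv]
  calc |Real.sinc (π * (x - k))| * ‖(x : ℂ) + α‖⁻¹
      ≤ 2 / (1 + |x - k|) * ((1 + (1 + ‖α‖) / α.im) * (1 + |x|)⁻¹) := by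
        gcongr
        exact abs_sinc_pi_mul_le _
    _ = _ := by rw [mul_inv]; ring

theorem exists_norm_sincDiv_natCast_le {n : ℕ} (hn : 0 < n) :
    ∃ C : ℝ, ∀ (k : ℕ) (x : ℝ), ‖sincDiv k n x‖ ≤ C * ((1 + |x - k|) * (1 + |x|))⁻¹ := by
  refine ⟨2 * (3 + 2 * n), fun k x ↦ ?_⟩
  have hn1 : (1 : ℝ) ≤ n := by exact_mod_cast hn
  have hk0 : (0 : ℝ) ≤ k := k.cast_nonneg
  have hnorm : ‖sincDiv k n x‖ = |Real.sinc (π * (x - k))| / |x + n| := by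
    rw [sincDiv, ← Complex.ofReal_natCast n, ← Complex.ofReal_add, norm_div, Complex.norm_real,
      Complex.norm_real, Real.norm_eq_abs, Real.norm_eq_abs]
  have hx : |x| ≤ |x + n| + n := by
    have := abs_sub (x + n) (n : ℝ)
    simpa using this
  rw [hnorm, ← div_eq_mul_inv]
  rcases le_total (1 / 2) |x + n| with h | h
  · have hpos : 0 < |x + n| := by linarith
    rw [div_le_div_iff₀ hpos (by positivity)]
    have h1 := abs_sinc_pi_mul_le (x - k)
    rw [le_div_iff₀ (by positivity)] at h1
    calc |Real.sinc (π * (x - k))| * ((1 + |x - k|) * (1 + |x|))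
        = |Real.sinc (π * (x - k))| * (1 + |x - k|) * (1 + |x|) := by ring
      _ ≤ 2 * ((3 + 2 * n) * |x + n|) := by
        gcongr
        nlinarith
      _ = _ := by ring
  · obtain ⟨hl, hr⟩ := abs_le.1 h
    have hd : 1 / 2 ≤ |x - k| := by
      rw [abs_of_nonpos (by linarith)]
      linarith
    have hxk : x - k ≠ 0 := by
      intro h0
      rw [h0] at hd
      norm_num at hd
    have hsin : |Real.sin (π * (x - k))| ≤ π * |x + n| := by
      have h1 : Real.sin (π * (x - k)) = (-1) ^ (k + n) * Real.sin (π * (x + n)) := by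
        rw [show π * (x - k) = π * (x + n) - ((k + n : ℕ) : ℝ) * π by push_cast; ring,
          Real.sin_sub_nat_mul_pi]
      rw [h1, abs_mul, abs_pow, abs_neg, abs_one, one_pow, one_mul]
      refine Real.abs_sin_le_abs.trans ?_
      rw [abs_mul, abs_of_pos Real.pi_pos]
    have hquot : |Real.sinc (π * (x - k))| / |x + n| ≤ 1 / |x - k| := by
      rw [Real.sinc_of_ne_zero (mul_ne_zero Real.pi_ne_zero hxk), abs_div, abs_mul,
        abs_of_pos Real.pi_pos]
      refine div_le_of_le_mul₀ (abs_nonneg _) (by positivity) ?_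
      rw [div_mul_eq_mul_div, one_mul, div_le_div_iff₀ (by positivity) (by positivity)]
      nlinarith [mul_le_mul_of_nonneg_right hsin (abs_nonneg (x - k))]
    refine hquot.trans ?_
    rw [div_le_div_iff₀ (by positivity) (by positivity)]
    have h1 : 1 + |x - k| ≤ 3 * |x - k| := by linarith
    have h2 : 1 + |x| ≤ 3 / 2 + n := by linarith
    calc 1 * ((1 + |x - k|) * (1 + |x|)) ≤ 1 * (3 * |x - k| * (3 / 2 + n)) := by gcongr
      _ ≤ 2 * (3 + 2 * n) * |x - k| := by nlinarith [abs_nonneg (x - k)]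

theorem inv_mul_inv_le_rpow {a b c δ : ℝ} (ha : 0 < a) (hb : 0 < b) (hc : 0 < c)
    (hcab : c ≤ a + b) (hδ0 : 0 ≤ δ) (hδ1 : δ ≤ 1) :
    (a * b)⁻¹ ≤ c ^ (-(1 - δ)) * (a ^ (-(1 + δ)) + b ^ (-(1 + δ))) := by
  have key : ∀ y : ℝ, 0 < y → y ≤ a + b → (y * (a + b))⁻¹ ≤ c ^ (-(1 - δ)) * y ^ (-(1 + δ)) := by
    intro y hy hyab
    rw [Real.rpow_neg hc.le, Real.rpow_neg hy.le, ← mul_inv]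
    refine inv_anti₀ (by positivity) ?_
    calc c ^ (1 - δ) * y ^ (1 + δ) = y * (c ^ (1 - δ) * y ^ δ) := by
          rw [Real.rpow_add hy, Real.rpow_one]; ring
      _ ≤ y * ((a + b) ^ (1 - δ) * (a + b) ^ δ) := by gcongr
      _ = y * (a + b) := by
          rw [← Real.rpow_add (by positivity), sub_add_cancel, Real.rpow_one]
  calc (a * b)⁻¹ = (a * (a + b))⁻¹ + (b * (a + b))⁻¹ := by field_simp; ring
    _ ≤ _ := (add_le_add (key a ha (by linarith)) (key b hb (by linarith))).trans_eq (by ring)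

theorem integrable_sincDiv_and_integral_norm_le {α : ℂ} {C : ℝ}
    (hC : ∀ (k : ℕ) (x : ℝ), ‖sincDiv k α x‖ ≤ C * ((1 + |x - k|) * (1 + |x|))⁻¹)
    {δ : ℝ} (hδ0 : 0 < δ) (hδ1 : δ ≤ 1) (k : ℕ) :
    Integrable (sincDiv k α) ∧ ∫ x, ‖sincDiv k α x‖ ≤
      C * (2 * ∫ x : ℝ, (1 + |x|) ^ (-(1 + δ))) * ((k : ℝ) + 1) ^ (-(1 - δ)) := by
  have hC0 : 0 ≤ C := by
    have := (norm_nonneg _).trans (hC 0 0)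
    simpa using this
  have hJ : Integrable fun x : ℝ ↦ (1 + |x|) ^ (-(1 + δ)) := by
    have := integrable_one_add_norm (E := ℝ) (μ := volume) (r := 1 + δ) (by simpa using hδ0)
    simpa only [Real.norm_eq_abs] using this
  have hG : Integrable fun x : ℝ ↦ C * (((k : ℝ) + 1) ^ (-(1 - δ)) *
      ((1 + |x - k|) ^ (-(1 + δ)) + (1 + |x|) ^ (-(1 + δ)))) :=
    (((hJ.comp_sub_right (k : ℝ)).add hJ).const_mul _).const_mul _
  have hle : ∀ x : ℝ, ‖sincDiv k α x‖ ≤ C * (((k : ℝ) + 1) ^ (-(1 - δ)) *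
      ((1 + |x - k|) ^ (-(1 + δ)) + (1 + |x|) ^ (-(1 + δ)))) := by
    intro x
    refine (hC k x).trans (mul_le_mul_of_nonneg_left ?_ hC0)
    refine inv_mul_inv_le_rpow (by positivity) (by positivity) (by positivity) ?_ hδ0.le hδ1
    have h1 := neg_abs_le (x - k)
    have h2 := le_abs_self x
    linarith
  have hInt : Integrable (sincDiv k α) :=
    hG.mono' (measurable_sincDiv k α).aestronglyMeasurable (.of_forall hle)
  refine ⟨hInt, (integral_mono hInt.norm hG hle).trans_eq ?_⟩
  rw [integral_const_mul, integral_const_mul, integral_add (hJ.comp_sub_right (k : ℝ)) hJ,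
    integral_sub_right_eq_self (fun x : ℝ ↦ (1 + |x|) ^ (-(1 + δ))) (k : ℝ)]
  ring

theorem exists_norm_sincDiv_le {α : ℂ} (hα : 0 < α.im ∨ ∃ n : ℕ, 0 < n ∧ α = (n : ℂ)) :
    ∃ C : ℝ, ∀ (k : ℕ) (x : ℝ), ‖sincDiv k α x‖ ≤ C * ((1 + |x - k|) * (1 + |x|))⁻¹ := by
  rcases hα with hα | ⟨n, hn, rfl⟩
  · exact exists_norm_sincDiv_le_of_im_pos hα
  · exact exists_norm_sincDiv_natCast_le hn

theorem integrable_sincDiv {α : ℂ} (hα : 0 < α.im ∨ ∃ n : ℕ, 0 < n ∧ α = (n : ℂ)) (k : ℕ) :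
    Integrable (sincDiv k α) := by
  obtain ⟨C, hC⟩ := exists_norm_sincDiv_le hα
  exact (integrable_sincDiv_and_integral_norm_le hC zero_lt_one le_rfl k).1

theorem natCast_add_ne_zero {α : ℂ} (hα : 0 < α.im ∨ ∃ n : ℕ, 0 < n ∧ α = (n : ℂ)) (k : ℕ) :
    (k : ℂ) + α ≠ 0 := by
  rcases hα with hα | ⟨n, hn, rfl⟩
  · intro h
    have := congrArg Complex.im h
    simp at this
    exact hα.ne' this
  · exact_mod_cast (Nat.add_pos_right k hn).ne'

theorem integral_sincDiv {α : ℂ} (hα : 0 < α.im ∨ ∃ n : ℕ, 0 < n ∧ α = (n : ℂ)) (k : ℕ) :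
    ∫ x, sincDiv k α x = (1 - (-1) ^ k * Complex.exp (Complex.I * π * α)) / (k + α) := by
  have hInt := integrable_sincDiv hα k
  have hne := natCast_add_ne_zero hα k
  rcases hα with hα | ⟨n, hn, rfl⟩
  · exact integral_sincDiv_of_integrable k hα hInt
  let β : ℝ → ℂ := fun ε ↦ n + ε * Complex.I
  have hβ : Filter.Tendsto β (nhdsWithin 0 (Set.Ioi 0)) (nhds (n : ℂ)) := by
    have : Continuous β := by fun_prop
    simpa [β] using (this.tendsto 0).mono_left nhdsWithin_le_nhds
  have hβim : ∀ ε : ℝ, 0 < ε → 0 < (β ε).im := fun ε hε ↦ by simpa [β] using hε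
  have hae : ∀ᵐ x : ℝ, x ≠ -n := by
    simpa using (Set.countable_singleton (-(n : ℝ))).ae_notMem volume
  have hne' : ∀ x : ℝ, x ≠ -n → (x : ℂ) + n ≠ 0 := fun x hx h ↦
    hx (eq_neg_of_add_eq_zero_left (by exact_mod_cast h))
  have hL : Filter.Tendsto (fun ε ↦ ∫ x, sincDiv k (β ε) x) (nhdsWithin 0 (Set.Ioi 0))
      (nhds (∫ x, sincDiv k n x)) := by
    refine tendsto_integral_filter_of_dominated_convergence (fun x ↦ ‖sincDiv k n x‖)
      (.of_forall fun ε ↦ (measurable_sincDiv k _).aestronglyMeasurable) ?_ hInt.norm ?_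
    · refine .of_forall fun ε ↦ ?_
      filter_upwards [hae] with x hx
      rw [sincDiv, sincDiv, norm_div, norm_div]
      have h1 : ‖(x : ℂ) + n‖ ≤ ‖(x : ℂ) + β ε‖ := by
        have h2 := Complex.abs_re_le_norm ((x : ℂ) + β ε)
        rw [← Complex.ofReal_natCast n, ← Complex.ofReal_add, Complex.norm_real]
        simpa [β] using h2
      exact div_le_div_of_nonneg_left (norm_nonneg _) (norm_pos_iff.2 (hne' x hx)) h1
    · filter_upwards [hae] with x hx
      exact tendsto_const_nhds.div (tendsto_const_nhds.add hβ) (hne' x hx)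
  have hR : Filter.Tendsto
      (fun ε ↦ (1 - (-1) ^ k * Complex.exp (Complex.I * π * β ε)) / (k + β ε))
      (nhdsWithin 0 (Set.Ioi 0))
      (nhds ((1 - (-1) ^ k * Complex.exp (Complex.I * π * n)) / (k + n))) :=
    (tendsto_const_nhds.sub (tendsto_const_nhds.mul
      ((Complex.continuous_exp.tendsto _).comp (tendsto_const_nhds.mul hβ)))).div
      (tendsto_const_nhds.add hβ) hne
  refine tendsto_nhds_unique hL (hR.congr' ?_)
  filter_upwards [self_mem_nhdsWithin] with ε hε
  exact (integral_sincDiv_of_integrable k (hβim ε hε)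
    (integrable_sincDiv (.inl (hβim ε hε)) k)).symm

theorem hasSum_cbinom_mul_sinc {w : ℂ} (hw : -1 < w.re) {x : ℝ} (hx : ∀ m : ℤ, x ≠ m) :
    HasSum (fun k : ℕ ↦ cbinom w k * (Real.sinc (π * (x - k)) : ℂ)) (cbinom w x) := by
  have hxk : ∀ k : ℕ, x - k ≠ 0 := fun k h ↦ hx k (by simpa using sub_eq_zero.1 h)
  have hxk' : ∀ k : ℕ, (k : ℂ) + -x ≠ 0 := fun k h ↦ hxk k (by
    have h' : ((x - k : ℝ) : ℂ) = 0 := by push_cast; linear_combination -h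
    exact_mod_cast h')
  have h := (hasSum_neg_one_pow_mul_cbinom_div hw hxk').mul_left (-(Complex.sin (π * x) / π))
  have hπ : (π : ℂ) ≠ 0 := by exact_mod_cast Real.pi_ne_zero
  convert! h using 1
  · ext k
    have h1 : (x : ℂ) - k ≠ 0 := fun h0 ↦ hxk' k (by linear_combination -h0)
    rw [Real.sinc_of_ne_zero (mul_ne_zero Real.pi_ne_zero (hxk k)), mul_sub, mul_comm π (k : ℝ),
      Real.sin_sub_nat_mul_pi]
    push_cast
    rw [show (k : ℂ) + -x = -(x - k) by ring, show (π : ℂ) * x - k * π = π * (x - k) by ring]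
    field_simp
  · have hx0 : (x : ℂ) ≠ 0 := fun h0 ↦ hx 0 (by simpa using h0)
    have hs : Complex.sin (π * x) ≠ 0 := fun h0 ↦ by
      rw [Complex.sin_eq_zero_iff] at h0
      obtain ⟨m, hm⟩ := h0
      refine hx m ?_
      have : (x : ℂ) = m := mul_left_cancel₀ hπ (by rw [hm]; ring)
      exact_mod_cast this
    have hrefl := Complex.Gamma_mul_Gamma_one_sub (-(x : ℂ))
    rw [mul_neg, Complex.sin_neg, sub_neg_eq_add, add_comm 1 (x : ℂ),
      eq_div_iff (neg_ne_zero.2 hs)] at hrefl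
    have hkey : -(Complex.sin (π * x) / π) * Complex.Gamma (-x) = (Complex.Gamma (x + 1))⁻¹ := by
      refine eq_inv_of_mul_eq_one_left ?_
      field_simp
      linear_combination hrefl
    rw [cbinom, cbeta, show w + 1 + -(x : ℂ) = w - x + 1 by ring, div_eq_mul_inv, mul_inv, ← hkey]
    ring

theorem integral_binom_div_linear (w : ℂ) (hw : -1 < w.re) (α : ℂ)
    (hα : 0 < α.im ∨ ∃ n : ℕ, 0 < n ∧ α = (n : ℂ)) :
    ∫ x : ℝ, cbinom w (x : ℂ) / ((x : ℂ) + α) =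
      (∑' k : ℕ, cbinom w (k : ℂ) / ((k : ℂ) + α)) -
        Complex.exp (Complex.I * π * α) * cbeta (w + 1) α := by
  obtain ⟨C, hC⟩ := exists_norm_sincDiv_le hα
  obtain ⟨δ, hδ0, hδ⟩ := exists_between (show 0 < min 1 (w.re + 1) by
    rw [lt_min_iff]; constructor <;> linarith)
  obtain ⟨hδ1, hδw⟩ := lt_min_iff.1 hδ
  have hsum : Summable fun k : ℕ ↦ ∫ x, ‖cbinom w k * sincDiv k α x‖ := by
    refine Summable.of_nonneg_of_le (fun k ↦ integral_nonneg fun x ↦ norm_nonneg _) (fun k ↦ ?_)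
      ((summable_norm_cbinom_mul_rpow hδ1.le hδw hw).mul_left
        (C * (2 * ∫ x : ℝ, (1 + |x|) ^ (-(1 + δ)))))
    simp_rw [norm_mul]
    rw [integral_const_mul]
    refine (mul_le_mul_of_nonneg_left
      (integrable_sincDiv_and_integral_norm_le hC hδ0 hδ1.le k).2 (norm_nonneg _)).trans_eq ?_
    ring
  have h := hasSum_integral_of_summable_integral_norm
    (fun k ↦ (integrable_sincDiv hα k).const_mul (cbinom w k)) hsum
  have hL : ∫ x : ℝ, cbinom w (x : ℂ) / ((x : ℂ) + α) =
      ∫ x : ℝ, ∑' k : ℕ, cbinom w k * sincDiv k α x := by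
    refine integral_congr_ae ?_
    filter_upwards [(Set.countable_range ((↑) : ℤ → ℝ)).ae_notMem volume] with x hx
    refine (HasSum.tsum_eq ?_).symm
    convert! (hasSum_cbinom_mul_sinc hw fun m hm ↦ hx ⟨m, hm.symm⟩).div_const ((x : ℂ) + α)
      using 2 with k
    rw [sincDiv, mul_div_assoc]
  rw [hL]
  refine h.unique ?_
  have hA := (Summable.of_norm (summable_cbinom_div_add hw α)).hasSum
  have hB := (hasSum_neg_one_pow_mul_cbinom_div hw (natCast_add_ne_zero hα)).mul_left
    (Complex.exp (Complex.I * π * α))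
  convert! hA.sub hB using 2 with k
  rw [integral_const_mul, integral_sincDiv hα]
  ring
end
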